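/- arXiv:2106.08195 — 5 statements merged into one kernel-verified Lean document; each statement's English description precedes it below -/
import Mathlib

section
/- For any strings x, y of length n ≥ 1 over an alphabet Σ, there exists a symbol σ ∈ Σ such that 2·n·#_σ(x) ≥ M(x,y) and 2·n·#_σ(y) ≥ M(x,y). Consequently, x and y have a common subsequence of length at least M(x,y)/(2n) consisting of repetitions of a single symbol. -/
/-- The number of matching pairs of strings `x` and `y`: index pairs `(i,j)` with `x[i] = y[j]`. -/
def mp {α : Type*} [DecidableEq α] (x y : List α) : ℕ :=
  (x.product y).countP fun p => decide (p.1 = p.2)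

/-- The length of the longest common subsequence of `x` and `y`. -/
noncomputable def lcs {α : Type*} (x y : List α) : ℕ :=
  sSup {n : ℕ | ∃ z : List α, z.length = n ∧ z.Sublist x ∧ z.Sublist y}

/-- A block sequence: a set of index pairs that is strictly increasing in both coordinates. -/
def BlockSeq {k : ℕ} (S : Finset (Fin k × Fin k)) : Prop :=
  ∀ p ∈ S, ∀ q ∈ S, p ≠ q → (p.1 < q.1 ∧ p.2 < q.2) ∨ (q.1 < p.1 ∧ q.2 < p.2)

theorem mp_eq_sum {α : Type*} [DecidableEq α] (x y : List α) :
    mp x y = (x.map fun a => y.count a).sum := by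
  unfold mp
  induction x with
  | nil => simp [List.product]
  | cons a x ih =>
    rw [show (a :: x).product y = y.map (fun b => (a, b)) ++ x.product y from rfl,
      List.countP_append, ih, List.map_cons, List.sum_cons, List.countP_map]
    congr 1
    rw [List.count]
    apply List.countP_congr
    intro b _
    simp [eq_comm (a := a) (b := b)]

/-- For strings `x, y` of length `n ≥ 1` there is a symbol `σ` with
`2·n·#_σ(x) ≥ M(x,y)` and `2·n·#_σ(y) ≥ M(x,y)`; consequently there is a common
subsequence of `x` and `y` of length at least `M(x,y)/(2n)` using only the symbol `σ`. -/
theorem single_symbol_approx {α : Type*} [DecidableEq α] (n : ℕ) (hn : 1 ≤ n)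
    (x y : List α) (hx : x.length = n) (hy : y.length = n) :
    ∃ σ : α, mp x y ≤ 2 * n * x.count σ ∧ mp x y ≤ 2 * n * y.count σ ∧
      ∃ z : List α, z.Sublist x ∧ z.Sublist y ∧ (∀ c ∈ z, c = σ) ∧
        mp x y ≤ 2 * n * z.length := by
  have hne : (x ++ y).toFinset.Nonempty := by
    cases x with
    | nil => simp at hx; omega
    | cons a x => exact ⟨a, by simp⟩
  obtain ⟨σ, -, hmax⟩ := Finset.exists_max_image (x ++ y).toFinset
    (fun a => min (x.count a) (y.count a)) hne
  have key : mp x y ≤ 2 * n * min (x.count σ) (y.count σ) := by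
    rw [mp_eq_sum, Finset.sum_list_map_count]
    calc ∑ a ∈ x.toFinset, x.count a • y.count a
        ≤ ∑ a ∈ (x ++ y).toFinset, x.count a • y.count a := by
          apply Finset.sum_le_sum_of_subset
          intro a ha
          simp at ha ⊢
          exact Or.inl ha
      _ ≤ ∑ a ∈ (x ++ y).toFinset, (x ++ y).count a * min (x.count σ) (y.count σ) := by
          apply Finset.sum_le_sum
          intro a ha
          have h := hmax a ha
          rw [smul_eq_mul, List.count_append, ← min_mul_max, mul_comm]
          exact Nat.mul_le_mul (by omega) h
      _ = 2 * n * min (x.count σ) (y.count σ) := by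
          rw [← Finset.sum_mul, List.sum_toFinset_count_eq_length, List.length_append, hx, hy,
            two_mul]
  refine ⟨σ, key.trans (Nat.mul_le_mul_left _ (min_le_left _ _)),
    key.trans (Nat.mul_le_mul_left _ (min_le_right _ _)),
    List.replicate (min (x.count σ) (y.count σ)) σ, ?_, ?_, ?_, ?_⟩
  · exact List.replicate_sublist_iff.2 (min_le_left _ _)
  · exact List.replicate_sublist_iff.2 (min_le_right _ _)
  · intro c hc
    exact List.eq_of_mem_replicate hc
  · simpa using key
end

section
/- Let x and y be strings of length n = k·m, each split into k consecutive blocks x_1,…,x_k and y_1,…,y_k of length m. Let L = L(x,y) ≥ 1 and let μ be the maximum of Σ_{(i,j)∈S} M(x_i,y_j) over all block sequences S. Then there exists a block sequence G with |G| ≥ L/(8m) such that every (i,j) ∈ G satisfies L(x_i,y_j) ≥ L·m/(4n) and L·M(x_i,y_j) ≤ 8·μ·m. In particular, Σ_{(i,j)∈G} L(x_i,y_j) ≥ L²/(32n). -/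
theorem bal_sum_biUnion {ι κ : Type*} [DecidableEq ι] [DecidableEq κ] (H : Finset ι)
    (t : ι → Finset κ) (l : κ → ℕ) : ∑ p ∈ H.biUnion t, l p ≤ ∑ h ∈ H, ∑ p ∈ t h, l p := by
  induction H using Finset.induction_on with
  | empty => simp
  | insert a s ha ih =>
    rw [Finset.biUnion_insert, Finset.sum_insert ha]
    have := Finset.sum_union_inter (s₁ := t a) (s₂ := s.biUnion t) (f := l)
    omega

theorem bal_le_lcs {α : Type*} {x y z : List α} (h1 : z.Sublist x) (h2 : z.Sublist y) :
    z.length ≤ lcs x y := by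
  unfold lcs
  apply le_csSup
  · refine ⟨x.length, ?_⟩
    rintro n ⟨w, rfl, hw, _⟩
    exact hw.length_le
  · exact ⟨z, rfl, h1, h2⟩

theorem bal_exists_lcs {α : Type*} (x y : List α) :
    ∃ z : List α, z.length = lcs x y ∧ z.Sublist x ∧ z.Sublist y := by
  have := Nat.sSup_mem (s := {n : ℕ | ∃ z : List α, z.length = n ∧ z.Sublist x ∧ z.Sublist y})
    ⟨0, [], rfl, List.nil_sublist _, List.nil_sublist _⟩
    ⟨x.length, by rintro n ⟨w, rfl, hw, _⟩; exact hw.length_le⟩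
  exact this

theorem bal_flatten {α : Type*} (m : ℕ) (ll : List (List α)) (h : ∀ l ∈ ll, l.length = m)
    (i r : ℕ) (hr : r < m) : (ll.flatten)[i * m + r]? = (ll[i]?).bind (fun l => l[r]?) := by
  induction ll generalizing i with
  | nil => simp
  | cons a t ih =>
    have ha : a.length = m := h a (by simp)
    cases i with
    | zero =>
      simp only [List.flatten_cons]
      rw [List.getElem?_append_left (by omega)]
      simp
    | succ i =>
      simp only [List.flatten_cons]
      rw [List.getElem?_append_right (by rw [ha]; nlinarith)]
      have : (i + 1) * m + r - a.length = i * m + r := by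
        rw [ha, add_mul]; omega
      rw [this, ih (fun l hl => h l (by simp [hl]))]
      simp

/-- positions of a common subsequence -/
theorem bal_embed {α : Type*} (k m : ℕ) (xb : Fin k → List α) (hxm : ∀ i, (xb i).length = m)
    (z : List α) (hz : z.Sublist (List.ofFn xb).flatten) :
    ∃ (f : Fin z.length → ℕ) (b : Fin z.length → Fin k), StrictMono f ∧
      ∀ t, f t / m = b t ∧ f t % m < m ∧ (xb (b t))[f t % m]? = some (z.get t) := by
  obtain ⟨f, hf⟩ := List.sublist_iff_exists_orderEmbedding_getElem?_eq.1 hz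
  have key : ∀ t : Fin z.length, ∃ b : Fin k, f t / m = b ∧ f t % m < m ∧
      (xb b)[f t % m]? = some (z.get t) := by
    intro t
    have h1 := hf t
    rw [List.getElem?_eq_getElem t.2] at h1
    have hlt : f t < ((List.ofFn xb).flatten).length := by
      by_contra hcon
      rw [List.getElem?_eq_none (by omega)] at h1
      simp at h1
    have hlen : ((List.ofFn xb).flatten).length = k * m := by
      simp [List.length_flatten, List.map_ofFn, Function.comp_def, hxm, List.sum_ofFn]
    rw [hlen] at hlt
    have hm : 0 < m := by
      rcases Nat.eq_zero_or_pos m with h | h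
      · subst h; simp at hlt
      · exact h
    have hb : f t / m < k := (Nat.div_lt_iff_lt_mul hm).2 hlt
    refine ⟨⟨f t / m, hb⟩, rfl, Nat.mod_lt _ hm, ?_⟩
    have h2 := bal_flatten m (List.ofFn xb) (by simp [List.mem_ofFn, hxm]) (f t / m) (f t % m)
      (Nat.mod_lt _ hm)
    rw [Nat.div_add_mod'] at h2
    rw [h2] at h1
    simp [hb] at h1
    simp [h1]
  choose b hb using key
  exact ⟨fun t => f t, b, fun s t hst => f.strictMono hst, hb⟩

theorem bal_sub {α : Type*} {k m N : ℕ} (xb : Fin k → List α) (hxm : ∀ i, (xb i).length = m)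
    (z : Fin N → α) (f : Fin N → ℕ) (b : Fin N → Fin k) (hf : StrictMono f)
    (h : ∀ t, f t / m = b t ∧ f t % m < m ∧ (xb (b t))[f t % m]? = some (z t))
    (i : Fin k) (c : ℕ) (e : Fin c → Fin N) (he : StrictMono e) (hi : ∀ s, b (e s) = i) :
    (List.ofFn (fun s => z (e s))).Sublist (xb i) := by
  rw [List.sublist_iff_exists_fin_orderEmbedding_get_eq]
  refine ⟨OrderEmbedding.ofStrictMono (fun s => ⟨f (e (Fin.cast (by simp) s)) % m, ?_⟩) ?_, ?_⟩
  · rw [hxm]; exact (h _).2.1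
  · intro s t hst
    have h1 : f (e (Fin.cast (by simp) s)) < f (e (Fin.cast (by simp) t)) := hf (he hst)
    have h2 := (h (e (Fin.cast (by simp) s))).1
    have h3 := (h (e (Fin.cast (by simp) t))).1
    rw [hi] at h2 h3
    rw [Fin.mk_lt_mk]
    have h4 := Nat.div_add_mod (f (e (Fin.cast (by simp) s))) m
    have h5 := Nat.div_add_mod (f (e (Fin.cast (by simp) t))) m
    rw [h2] at h4
    rw [h3] at h5
    omega
  · intro s
    have h2 := (h (e (Fin.cast (by simp) s))).2.2
    rw [hi] at h2
    rw [List.getElem?_eq_some_iff] at h2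
    obtain ⟨_, h2⟩ := h2
    simp only [List.get_eq_getElem, List.getElem_ofFn, OrderEmbedding.coe_ofStrictMono]
    exact h2.symm

theorem bal_fiber {k m N : ℕ} (f : Fin N → ℕ) (b : Fin N → Fin k) (hf : StrictMono f)
    (h : ∀ t, f t / m = b t ∧ f t % m < m) (i : Fin k) :
    (Finset.univ.filter (fun t => b t = i)).card ≤ m := by
  have : (Finset.univ.filter (fun t => b t = i)).card ≤ (Finset.range m).card := by
    apply Finset.card_le_card_of_injOn (fun t => f t % m)
    · intro t _
      simpa using (h t).2
    · intro s hs t ht hst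
      simp at hs ht hst
      apply hf.injective
      rw [← Nat.div_add_mod (f s) m, ← Nat.div_add_mod (f t) m, (h s).1, (h t).1, hs, ht, hst]
  simpa using this

theorem bal_comb (k m L : ℕ) (hL : 1 ≤ L) (l : Fin k × Fin k → ℕ)
    (hrow : ∀ i, ∑ p with p.1 = i, l p ≤ m) (hcol : ∀ i, ∑ p with p.2 = i, l p ≤ m)
    (hch : ∀ p q, l p ≠ 0 → l q ≠ 0 → p ≤ q ∨ q ≤ p) (hs : ∑ p, l p = L) :
    ∃ H : Finset (Fin k × Fin k), BlockSeq H ∧ L ≤ 4 * m * H.card ∧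
      ∀ p ∈ H, L ≤ 4 * k * l p := by
  classical
  have hk : 0 < k := by
    rcases Nat.eq_zero_or_pos k with h | h
    · subst h; simp at hs; omega
    · exact h
  let A : Finset (Fin k × Fin k) := Finset.univ.filter (fun p => L ≤ 4 * k * l p)
  let B : Finset (Fin k × Fin k) := Finset.univ.filter (fun p => l p ≠ 0 ∧ 4 * k * l p < L)
  have hA0 : ∀ p ∈ A, l p ≠ 0 := by
    intro p hp h0
    simp [A, h0] at hp; omega
  have hBcard : B.card ≤ 2 * k := by
    have : B.card ≤ (Finset.range (2 * k)).card := by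
      apply Finset.card_le_card_of_injOn (fun p => p.1.val + p.2.val)
      · intro p _
        have := p.1.2
        have := p.2.2
        simp; omega
      · intro p hp q hq hpq
        simp [B] at hp hq hpq
        rcases hch p q hp.1 hq.1 with h | h
        all_goals
          have h1 : _ ≤ _ := h.1
          have h2 : _ ≤ _ := h.2
          rw [Fin.le_def] at h1 h2
          ext <;> omega
    simpa using this
  have hBsum : 4 * k * ∑ p ∈ B, l p ≤ 2 * k * L := by
    rw [Finset.mul_sum]
    calc ∑ p ∈ B, 4 * k * l p ≤ ∑ p ∈ B, L := by
          apply Finset.sum_le_sum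
          intro p hp
          simp [B] at hp
          exact hp.2.le
      _ = B.card * L := by simp
      _ ≤ _ := Nat.mul_le_mul_right _ hBcard
  have hBsum' : 2 * ∑ p ∈ B, l p ≤ L := by
    have : (2 * k) * (2 * ∑ p ∈ B, l p) ≤ (2 * k) * L := by linarith
    exact Nat.le_of_mul_le_mul_left this (by omega)
  have hAB : L ≤ ∑ p ∈ A, l p + ∑ p ∈ B, l p := by
    rw [← hs, ← Finset.sum_filter_add_sum_filter_not Finset.univ (fun p => L ≤ 4 * k * l p)]
    apply Nat.add_le_add_left
    apply le_of_eq
    symm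
    apply Finset.sum_subset
    · intro p hp
      simp [B] at hp ⊢
      exact hp.2
    · intro p hp hp'
      simp [B] at hp hp'
      by_contra h0
      exact absurd (hp' h0) (by omega)
  obtain ⟨H, hH, hmax⟩ := Finset.exists_max_image
    (A.powerset.filter (fun S => BlockSeq S)) Finset.card
    ⟨∅, by simp [BlockSeq]⟩
  simp only [Finset.mem_filter, Finset.mem_powerset] at hH hmax
  refine ⟨H, hH.2, ?_, fun p hp => by simpa [A] using hH.1 hp⟩
  have hcover : A ⊆ H.biUnion (fun h => Finset.univ.filter (fun p => p.1 = h.1) ∪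
      Finset.univ.filter (fun p => p.2 = h.2)) := by
    intro p hp
    simp only [Finset.mem_biUnion, Finset.mem_union, Finset.mem_filter, Finset.mem_univ, true_and]
    by_contra hcon
    push Not at hcon
    have hpH : p ∉ H := fun h => (hcon p h).1 rfl
    have hcomp : ∀ q ∈ H, (p.1 < q.1 ∧ p.2 < q.2) ∨ (q.1 < p.1 ∧ q.2 < p.2) := by
      intro q hq
      obtain ⟨n1, n2⟩ := hcon q hq
      rcases hch p q (hA0 p hp) (hA0 q (hH.1 hq)) with h | h
      · exact Or.inl ⟨lt_of_le_of_ne h.1 n1, lt_of_le_of_ne h.2 n2⟩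
      · exact Or.inr ⟨lt_of_le_of_ne h.1 n1.symm, lt_of_le_of_ne h.2 n2.symm⟩
    have := hmax (insert p H) ⟨Finset.insert_subset hp hH.1, by
      intro a ha b hb hab
      rw [Finset.mem_insert] at ha hb
      rcases ha with rfl | ha <;> rcases hb with rfl | hb
      · exact absurd rfl hab
      · exact hcomp b hb
      · exact (hcomp a ha).symm
      · exact hH.2 a ha b hb hab⟩
    rw [Finset.card_insert_of_notMem hpH] at this
    omega
  have hAsum : ∑ p ∈ A, l p ≤ H.card * (2 * m) := by
    calc ∑ p ∈ A, l p ≤ _ := Finset.sum_le_sum_of_subset hcover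
      _ ≤ ∑ h ∈ H, ∑ p ∈ (Finset.univ.filter (fun p => p.1 = h.1) ∪
            Finset.univ.filter (fun p => p.2 = h.2)), l p := bal_sum_biUnion _ _ _
      _ ≤ ∑ h ∈ H, 2 * m := by
          apply Finset.sum_le_sum
          intro h _
          have e := Finset.sum_union_inter (s₁ := Finset.univ.filter (fun p : Fin k × Fin k => p.1 = h.1))
            (s₂ := Finset.univ.filter (fun p : Fin k × Fin k => p.2 = h.2)) (f := l)
          have := hrow h.1
          have := hcol h.2
          omega
      _ = _ := by simp
  nlinarith

/-- Existence of a block sequence `G` with `|G| ≥ L/(8m)` such that every block in `G`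
has LCS at least `L·m/(4n)` and at most `8·μ·m / L` matching pairs; in particular the
blocks of `G` have total LCS at least `L²/(32n)`. -/
theorem block_aligned_lcs {α : Type*} [DecidableEq α] (k m n L μ : ℕ)
    (hn : n = k * m)
    (xb yb : Fin k → List α)
    (hxm : ∀ i, (xb i).length = m) (hym : ∀ i, (yb i).length = m)
    (x y : List α) (hx : x = (List.ofFn xb).flatten) (hy : y = (List.ofFn yb).flatten)
    (hL : L = lcs x y) (hL1 : 1 ≤ L)
    (hμ : IsGreatest {s : ℕ | ∃ S : Finset (Fin k × Fin k), BlockSeq S ∧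
        s = ∑ p ∈ S, mp (xb p.1) (yb p.2)} μ) :
    ∃ G : Finset (Fin k × Fin k), BlockSeq G ∧ L ≤ 8 * m * G.card ∧
      (∀ p ∈ G, L * m ≤ 4 * n * lcs (xb p.1) (yb p.2) ∧
        L * mp (xb p.1) (yb p.2) ≤ 8 * μ * m) ∧
      L ^ 2 ≤ 32 * n * ∑ p ∈ G, lcs (xb p.1) (yb p.2) := by
  classical
  obtain ⟨z, hzl, hzx, hzy⟩ := bal_exists_lcs x y
  subst hx hy
  obtain ⟨f, b, hf, hfb⟩ := bal_embed k m xb hxm z hzx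
  obtain ⟨g, c, hg, hgc⟩ := bal_embed k m yb hym z hzy
  let φ : Fin z.length → Fin k × Fin k := fun t => (b t, c t)
  let l : Fin k × Fin k → ℕ := fun p => (Finset.univ.filter (fun t => φ t = p)).card
  have hbm : Monotone b := fun s t hst => by
    rw [Fin.le_def, ← (hfb s).1, ← (hfb t).1]
    exact Nat.div_le_div_right (hf.monotone hst)
  have hcm : Monotone c := fun s t hst => by
    rw [Fin.le_def, ← (hgc s).1, ← (hgc t).1]
    exact Nat.div_le_div_right (hg.monotone hst)
  have hsum : ∀ P : Finset (Fin k × Fin k), ∑ p ∈ P, l p =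
      (Finset.univ.filter (fun t => φ t ∈ P)).card := by
    intro P
    rw [Finset.card_eq_sum_card_fiberwise (f := φ) (t := P) (by intro t ht; simpa using ht)]
    apply Finset.sum_congr rfl
    intro p hp
    simp only [l]
    congr 1
    ext t
    simp
    rintro rfl
    exact hp
  have hlcs : ∀ p, l p ≤ lcs (xb p.1) (yb p.2) := by
    intro p
    let T := Finset.univ.filter (fun t => φ t = p)
    let e := T.orderEmbOfFin rfl
    have heT : ∀ s, φ (e s) = p := fun s => by
      have := T.orderEmbOfFin_mem rfl s
      exact (Finset.mem_filter.1 this).2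
    have h1 := bal_sub xb hxm z.get f b hf hfb p.1 T.card e e.strictMono
      (fun s => congrArg Prod.fst (heT s))
    have h2 := bal_sub yb hym z.get g c hg hgc p.2 T.card e e.strictMono
      (fun s => congrArg Prod.snd (heT s))
    have := bal_le_lcs h1 h2
    rw [List.length_ofFn] at this
    exact this
  obtain ⟨H, hH, hHc, hHl⟩ := bal_comb k m L hL1 l
    (by
      intro i
      rw [hsum]
      simpa [φ] using bal_fiber f b hf (fun t => ⟨(hfb t).1, (hfb t).2.1⟩) i)
    (by
      intro i
      rw [hsum]
      simpa [φ] using bal_fiber g c hg (fun t => ⟨(hgc t).1, (hgc t).2.1⟩) i)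
    (by
      intro p q hp hq
      simp only [l, ne_eq, Finset.card_eq_zero, ← Finset.nonempty_iff_ne_empty] at hp hq
      obtain ⟨s, hs⟩ := hp
      obtain ⟨t, ht⟩ := hq
      simp only [Finset.mem_filter, Finset.mem_univ, true_and] at hs ht
      subst hs ht
      rcases le_total s t with h | h
      · exact Or.inl ⟨hbm h, hcm h⟩
      · exact Or.inr ⟨hbm h, hcm h⟩)
    (by rw [hsum]; simp [hzl, hL])
  have hle : ∑ p ∈ H, mp (xb p.1) (yb p.2) ≤ μ := hμ.2 ⟨H, hH, rfl⟩
  let G := H.filter (fun p => L * mp (xb p.1) (yb p.2) ≤ 8 * μ * m)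
  let C := H.filter (fun p => ¬ L * mp (xb p.1) (yb p.2) ≤ 8 * μ * m)
  have hGC : G.card + C.card = H.card := Finset.card_filter_add_card_filter_not _
  have hCsum : ∑ p ∈ C, mp (xb p.1) (yb p.2) ≤ μ :=
    (Finset.sum_le_sum_of_subset (Finset.filter_subset _ _)).trans hle
  have hC : 8 * m * C.card ≤ L := by
    have h1 : C.card * (8 * μ * m + 1) ≤ L * μ := by
      calc C.card * (8 * μ * m + 1) = ∑ p ∈ C, (8 * μ * m + 1) := by simp
        _ ≤ ∑ p ∈ C, L * mp (xb p.1) (yb p.2) := by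
            apply Finset.sum_le_sum
            intro p hp
            have := (Finset.mem_filter.1 hp).2
            omega
        _ = L * ∑ p ∈ C, mp (xb p.1) (yb p.2) := by rw [Finset.mul_sum]
        _ ≤ _ := Nat.mul_le_mul_left _ hCsum
    rcases Nat.eq_zero_or_pos μ with h0 | h0
    · subst h0
      have : C.card = 0 := by simpa using h1
      simp [this]
    · have : μ * (8 * m * C.card) ≤ μ * L := by nlinarith
      exact Nat.le_of_mul_le_mul_left this h0
  have hGcard : L ≤ 8 * m * G.card := by
    rw [← hGC] at hHc
    nlinarith
  have hGl : ∀ p ∈ G, L ≤ 4 * k * lcs (xb p.1) (yb p.2) := fun p hp =>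
    (hHl p (Finset.mem_filter.1 hp).1).trans (Nat.mul_le_mul_left _ (hlcs p))
  refine ⟨G, fun p hp q hq => hH p (Finset.mem_filter.1 hp).1 q (Finset.mem_filter.1 hq).1,
    hGcard, fun p hp => ⟨?_, (Finset.mem_filter.1 hp).2⟩, ?_⟩
  · have := Nat.mul_le_mul_right m (hGl p hp)
    rw [hn]
    linarith
  · have h1 : G.card * L ≤ 4 * k * ∑ p ∈ G, lcs (xb p.1) (yb p.2) := by
      rw [Finset.mul_sum, ← smul_eq_mul, ← Finset.sum_const]
      exact Finset.sum_le_sum hGl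
    have h2 := Nat.mul_le_mul_left (8 * m) h1
    have h3 := Nat.mul_le_mul_right L hGcard
    rw [hn]
    linarith
end

section
/- Let x and y be strings of length n = k·m, each split into k consecutive blocks x_1,…,x_k and y_1,…,y_k of length m, with m ≥ 2. Let T = k², let λ = Σ_{i,j ∈ [k]} L(x_i,y_j) ≥ 1, and let λ̂ be a real number with λ/2 ≤ λ̂ ≤ λ. Then there exists an integer power of two g with max{1, λ̂/(4T)} ≤ g ≤ m such that g · |{(i,j) ∈ [k]×[k] : g ≤ L(x_i,y_j) ≤ 2g}| ≥ λ/(4·log₂ m + 4). -/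
theorem lcs_le_left {α : Type*} (x y : List α) : lcs x y ≤ x.length := by
  unfold lcs
  apply csSup_le'
  rintro n ⟨z, hz, hx, -⟩
  rw [← hz]
  exact hx.length_le

theorem scale_aux {ι : Type*} [Fintype ι] (a : ι → ℕ) (m : ℕ) (hm : 2 ≤ m)
    (ha : ∀ i, a i ≤ m) (lam : ℕ) (hlam : lam = ∑ i, a i) (hlam1 : 1 ≤ lam)
    (t : ℝ) (ht0 : 0 ≤ t) (ht : 4 * (Fintype.card ι : ℝ) * t ≤ lam) :
    ∃ ℓ : ℕ, t ≤ (2 ^ ℓ : ℝ) ∧ (2 : ℕ) ^ ℓ ≤ m ∧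
      (lam : ℝ) / (4 * Real.logb 2 m + 4) ≤
        (2 ^ ℓ : ℝ) * ((Finset.univ.filter (fun p : ι =>
          2 ^ ℓ ≤ a p ∧ a p ≤ 2 ^ (ℓ + 1))).card : ℝ) := by
  classical
  by_contra! H
  set c : ℝ := (lam : ℝ) / (4 * Real.logb 2 m + 4) with hc
  set K := Nat.log 2 m with hK
  set G := (Finset.range (K + 1)).filter (fun ℓ => t ≤ (2 ^ ℓ : ℝ)) with hG
  have hl1 : (1 : ℝ) ≤ lam := by exact_mod_cast hlam1
  have hKlog : (K : ℝ) ≤ Real.logb 2 m := by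
    rw [Real.le_logb_iff_rpow_le (by norm_num) (by positivity)]
    rw [Real.rpow_natCast]
    exact_mod_cast Nat.pow_log_le_self 2 (by omega)
  have hK0 : (0 : ℝ) ≤ K := by positivity
  have hcpos : 0 ≤ c := by
    apply div_nonneg <;> linarith
  have hKc : ((K : ℝ) + 1) * (4 * c) ≤ lam := by
    have : c * (4 * Real.logb 2 m + 4) = lam := by
      rw [hc]; apply div_mul_cancel₀; linarith
    nlinarith
  have hpt : ∀ p, (a p : ℝ) ≤ 2 * t + ∑ ℓ ∈ G, 2 * (2 ^ ℓ : ℝ) *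
      (if 2 ^ ℓ ≤ a p ∧ a p ≤ 2 ^ (ℓ + 1) then 1 else 0) := by
    intro p
    have hnn : ∀ ℓ ∈ G, 0 ≤ 2 * (2 ^ ℓ : ℝ) *
      (if 2 ^ ℓ ≤ a p ∧ a p ≤ 2 ^ (ℓ + 1) then 1 else 0) := by
      intro ℓ _; positivity
    have hs := Finset.sum_nonneg hnn
    rcases Nat.eq_zero_or_pos (a p) with h0 | h0
    · rw [h0] at hs ⊢
      push_cast
      linarith
    · have e1 : 2 ^ (Nat.log 2 (a p)) ≤ a p := Nat.pow_log_le_self 2 (by omega)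
      have e2 : a p < 2 ^ (Nat.log 2 (a p) + 1) := Nat.lt_pow_succ_log_self (by norm_num) _
      have e3 : (a p : ℝ) ≤ 2 * 2 ^ (Nat.log 2 (a p)) := by
        have : (a p : ℝ) < 2 ^ (Nat.log 2 (a p) + 1) := by exact_mod_cast e2
        rw [pow_succ] at this
        linarith
      by_cases hg : t ≤ (2 : ℝ) ^ (Nat.log 2 (a p))
      · have hmem : Nat.log 2 (a p) ∈ G := by
          rw [hG, Finset.mem_filter, Finset.mem_range]
          exact ⟨Nat.lt_succ_of_le (Nat.log_mono_right (ha p)), hg⟩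
        have := Finset.single_le_sum hnn hmem
        rw [if_pos ⟨e1, e2.le⟩] at this
        linarith
      · push Not at hg
        linarith
  have hsum : (lam : ℝ) ≤ Fintype.card ι * (2 * t) + ∑ ℓ ∈ G, 2 * ((2 ^ ℓ : ℝ) *
      ((Finset.univ.filter (fun p : ι => 2 ^ ℓ ≤ a p ∧ a p ≤ 2 ^ (ℓ + 1))).card : ℝ)) := by
    have := Finset.sum_le_sum (fun p (_ : p ∈ (Finset.univ : Finset ι)) => hpt p)
    rw [Finset.sum_add_distrib, Finset.sum_comm] at this
    simp only [← Finset.mul_sum, Finset.sum_boole, Finset.sum_const, nsmul_eq_mul,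
      Finset.card_univ, mul_assoc] at this
    rw [hlam]
    push_cast
    rw [← Finset.mul_sum]
    linarith
  have hH : ∀ ℓ ∈ G, 2 * ((2 ^ ℓ : ℝ) *
      ((Finset.univ.filter (fun p : ι => 2 ^ ℓ ≤ a p ∧ a p ≤ 2 ^ (ℓ + 1))).card : ℝ)) < 2 * c := by
    intro ℓ hℓ
    rw [hG, Finset.mem_filter, Finset.mem_range] at hℓ
    have := H ℓ hℓ.2 (Nat.pow_le_of_le_log (by omega) (by omega))
    linarith
  rcases G.eq_empty_or_nonempty with he | hne
  · rw [he, Finset.sum_empty] at hsum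
    linarith
  · have h3 := Finset.sum_lt_sum_of_nonempty hne hH
    rw [Finset.sum_const, nsmul_eq_mul] at h3
    have hcard : (G.card : ℝ) ≤ K + 1 := by
      have : G.card ≤ _ := Finset.card_filter_le (Finset.range (K + 1)) (fun ℓ => t ≤ (2 ^ ℓ : ℝ))
      rw [Finset.card_range] at this
      exact_mod_cast this
    nlinarith

/-- There is a power of two `g` with `max{1, λ̂/(4T)} ≤ g ≤ m` such that
`g · |{(i,j) : g ≤ L(x_i,y_j) ≤ 2g}| ≥ λ/(4·log₂ m + 4)`. -/
theorem exists_good_scale {α : Type*} (k m n : ℕ) (hm : 2 ≤ m) (hn : n = k * m)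
    (xb yb : Fin k → List α)
    (hxm : ∀ i, (xb i).length = m) (hym : ∀ i, (yb i).length = m)
    (T : ℕ) (hT : T = k ^ 2)
    (lam : ℕ) (hlam : lam = ∑ i : Fin k, ∑ j : Fin k, lcs (xb i) (yb j))
    (hlam1 : 1 ≤ lam)
    (lamhat : ℝ) (h1 : (lam : ℝ) / 2 ≤ lamhat) (h2 : lamhat ≤ (lam : ℝ)) :
    ∃ ℓ : ℕ, max 1 (lamhat / (4 * T)) ≤ (2 ^ ℓ : ℝ) ∧ (2 : ℕ) ^ ℓ ≤ m ∧
      (lam : ℝ) / (4 * Real.logb 2 m + 4) ≤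
        (2 ^ ℓ : ℝ) * ((Finset.univ.filter (fun p : Fin k × Fin k =>
          2 ^ ℓ ≤ lcs (xb p.1) (yb p.2) ∧ lcs (xb p.1) (yb p.2) ≤ 2 ^ (ℓ + 1))).card : ℝ) := by
  have hk : 0 < k := by
    rcases Nat.eq_zero_or_pos k with h | h
    · subst h
      simp at hlam
      omega
    · exact h
  have hTpos : (0 : ℝ) < T := by
    rw [hT]; positivity
  have hl1 : (1 : ℝ) ≤ lam := by exact_mod_cast hlam1
  obtain ⟨ℓ, h3, h4, h5⟩ := scale_aux (fun p : Fin k × Fin k => lcs (xb p.1) (yb p.2)) m hm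
    (fun p => (lcs_le_left _ _).trans (hxm _).le) lam
    (by rw [hlam, Fintype.sum_prod_type]) hlam1 (lamhat / (4 * T))
    (by apply div_nonneg <;> linarith)
    (by
      have : (Fintype.card (Fin k × Fin k) : ℝ) = T := by
        rw [hT]; simp [sq]
      rw [this, mul_div_cancel₀ _ (by positivity)]
      exact h2)
  exact ⟨ℓ, max_le (one_le_pow₀ (by norm_num)) h3, h4, h5⟩
end

section
/- Let s and t be strings of length m ≥ 1 over an alphabet Σ with M = M(s,t) ≥ 1. Then there exists a set Λ ⊆ Σ of symbols such that every σ ∈ Λ satisfies 16·m·#_σ(s) ≥ M and 16·m·#_σ(t) ≥ M, and moreover 8·Σ_{σ∈Λ} #_σ(s)·#_σ(t) ≥ M. -/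
lemma mp_eq_aux {α : Type*} [DecidableEq α] (s t : List α) :
    mp s t = (s.map (fun a => t.count a)).sum := by
  unfold mp
  induction s with
  | nil => simp [List.product]
  | cons a s ih =>
    have hp : (a :: s).product t = t.map (fun b => (a, b)) ++ s.product t := List.product_cons a s t
    rw [hp, List.countP_append, ih, List.countP_map, List.map_cons, List.sum_cons]
    congr 1
    rw [List.count]
    apply List.countP_congr
    intro x _
    simp only [Function.comp, decide_eq_true_eq, beq_iff_eq]
    exact eq_comm

lemma sum_count_le_aux {α : Type*} [DecidableEq α] (S : Finset α) (t : List α) :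
    ∑ σ ∈ S, t.count σ ≤ t.length := by
  induction t with
  | nil => simp
  | cons a t ih =>
    simp only [List.count_cons, Finset.sum_add_distrib, List.length_cons]
    have : ∑ σ ∈ S, (if (a == σ) = true then 1 else 0) ≤ 1 := by
      simp only [beq_iff_eq, Finset.sum_ite_eq]
      split_ifs <;> simp
    omega

/-- There is a set `Λ` of symbols, each appearing at least `M/(16m)` times in both `s`
and `t`, whose matching pairs account for at least `M/8`. -/
theorem frequent_symbols_set {α : Type*} [DecidableEq α] (m : ℕ) (hm : 1 ≤ m)
    (s t : List α) (hs : s.length = m) (ht : t.length = m)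
    (hM : 1 ≤ mp s t) :
    ∃ Λ : Finset α,
      (∀ σ ∈ Λ, mp s t ≤ 16 * m * s.count σ ∧ mp s t ≤ 16 * m * t.count σ) ∧
      mp s t ≤ 8 * ∑ σ ∈ Λ, s.count σ * t.count σ := by
  have hsum : mp s t = ∑ σ ∈ s.toFinset, s.count σ * t.count σ := by
    rw [mp_eq_aux, Finset.sum_list_map_count]
    simp
  generalize mp s t = M at *
  refine ⟨s.toFinset.filter (fun σ => M ≤ 16 * m * s.count σ ∧ M ≤ 16 * m * t.count σ),
    fun σ h => (Finset.mem_filter.1 h).2, ?_⟩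
  rw [Finset.sum_filter]
  have key : ∑ σ ∈ s.toFinset, 16 * m * (s.count σ * t.count σ) ≤
      ∑ σ ∈ s.toFinset, (16 * m * (if M ≤ 16 * m * s.count σ ∧ M ≤ 16 * m * t.count σ then
        s.count σ * t.count σ else 0) + M * (s.count σ + t.count σ)) := by
    apply Finset.sum_le_sum
    intro σ _
    split_ifs with h
    · exact Nat.le_add_right _ _
    · rw [not_and_or, not_le, not_le] at h
      rcases h with h | h
      · nlinarith [Nat.mul_le_mul_right (t.count σ) h.le, Nat.zero_le (M * s.count σ)]
      · nlinarith [Nat.mul_le_mul_right (s.count σ) h.le, Nat.zero_le (M * t.count σ)]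
  rw [Finset.sum_add_distrib, ← Finset.mul_sum, ← Finset.mul_sum, ← Finset.mul_sum, ← hsum,
    Finset.sum_add_distrib] at key
  have h1 := sum_count_le_aux s.toFinset s
  have h2 := sum_count_le_aux s.toFinset t
  rw [hs] at h1
  rw [ht] at h2
  have h3 := Nat.mul_le_mul_left M (Nat.add_le_add h1 h2)
  generalize (∑ σ ∈ s.toFinset, if M ≤ 16 * m * s.count σ ∧ M ≤ 16 * m * t.count σ then
        s.count σ * t.count σ else 0) = G at *
  have h4 : m * (16 * M) ≤ m * (16 * G + 2 * M) := by nlinarith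
  have h5 := Nat.le_of_mul_le_mul_left h4 hm
  omega
end

section
/- Let x, y be strings of length n that have a common subsequence of length L, let p ∈ [0,1], and consider the product Bernoulli measure on masks ω ∈ {0,1}^n in which each coordinate ω_i independently equals 1 with probability p. Let x' be the subsequence of x consisting of the positions i with ω_i = 1. Then for every integer t, the probability that x' and y have a common subsequence of length at least t is at least the probability that a Binomial(L,p) random variable is at least t; that is, L(x',y) stochastically dominates Bin(L,p). -/
open Classical

noncomputable def binTail (p : ℝ) (L t : ℕ) : ℝ :=
  ∑ ij ∈ Finset.HasAntidiagonal.antidiagonal L,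
    (L.choose ij.1 : ℝ) * (p ^ ij.1 * (1 - p) ^ ij.2 * if t ≤ ij.1 then 1 else 0)

lemma binTail_succ (p : ℝ) (L t : ℕ) :
    binTail p (L + 1) t = p * binTail p L (t - 1) + (1 - p) * binTail p L t := by
  unfold binTail
  rw [Finset.sum_antidiagonal_choose_succ_mul
    (fun i j => p ^ i * (1 - p) ^ j * if t ≤ i then (1 : ℝ) else 0), add_comm,
    Finset.mul_sum, Finset.mul_sum]
  congr 1
  · apply Finset.sum_congr rfl
    intro ij hij
    rw [Finset.HasAntidiagonal.mem_antidiagonal] at hij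
    have h1 : (L.choose ij.2) = L.choose ij.1 := by
      rw [← hij]; exact (Nat.choose_symm_add).symm
    have h2 : (t ≤ ij.1 + 1) ↔ (t - 1 ≤ ij.1) := by omega
    simp only [h1, h2]
    ring
  · apply Finset.sum_congr rfl
    intro ij hij
    ring

lemma binTail_eq (p : ℝ) (L t : ℕ) :
    ∑ j ∈ Finset.Icc t L, (L.choose j : ℝ) * p ^ j * (1 - p) ^ (L - j) = binTail p L t := by
  unfold binTail
  rw [Finset.Nat.sum_antidiagonal_eq_sum_range_succ
    (fun i j => (L.choose i : ℝ) * (p ^ i * (1 - p) ^ j * if t ≤ i then 1 else 0))]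
  simp only [mul_ite, mul_one, mul_zero]
  rw [← Finset.sum_filter]
  apply Finset.sum_congr
  · ext j; simp; omega
  · intros; ring

def maskL {α : Type*} {n : ℕ} (g : Fin n → α) (ω : Fin n → Bool) : List α :=
  ((List.finRange n).filter (fun i => ω i)).map g

lemma maskL_cons {α : Type*} {n : ℕ} (g : Fin (n + 1) → α) (b : Bool) (ω : Fin n → Bool) :
    maskL g (Fin.cons b ω : Fin (n + 1) → Bool) =
      if b then g 0 :: maskL (fun i => g i.succ) ω else maskL (fun i => g i.succ) ω := by
  unfold maskL
  rw [List.finRange_succ, List.filter_cons]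
  cases b <;> simp [List.filter_map, Function.comp_def]

noncomputable def evP {n : ℕ} (p : ℝ) (E : (Fin n → Bool) → Prop) : ℝ :=
  ∑ ω ∈ Finset.univ.filter E, ∏ i, if ω i then p else 1 - p

lemma evP_mono {n : ℕ} {p : ℝ} (hp0 : 0 ≤ p) (hp1 : p ≤ 1) {E F : (Fin n → Bool) → Prop}
    (h : ∀ ω, E ω → F ω) : evP p E ≤ evP p F := by
  unfold evP
  apply Finset.sum_le_sum_of_subset_of_nonneg
  · intro ω; simpa using h ω
  · intro ω _ _
    apply Finset.prod_nonneg
    intro i _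
    split_ifs <;> linarith

lemma evP_succ {n : ℕ} (p : ℝ) (E : (Fin (n + 1) → Bool) → Prop) :
    evP p E = p * evP p (fun ω => E (Fin.cons true ω)) +
      (1 - p) * evP p (fun ω => E (Fin.cons false ω)) := by
  unfold evP
  simp only [Finset.sum_filter]
  rw [← (Fin.consEquiv (fun _ : Fin (n + 1) => Bool)).sum_comp, Fintype.sum_prod_type,
    Fintype.sum_bool, Finset.mul_sum, Finset.mul_sum]
  simp [Fin.consEquiv, Fin.prod_univ_succ]

lemma key {α : Type*} {p : ℝ} (hp0 : 0 ≤ p) (hp1 : p ≤ 1) (n : ℕ) :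
    ∀ (g : Fin n → α) (z : List α), z.Sublist (List.ofFn g) → ∀ t : ℕ,
    binTail p z.length t ≤
      evP p (fun ω => ∃ w : List α, t ≤ w.length ∧ w.Sublist z ∧ w.Sublist (maskL g ω)) := by
  induction n with
  | zero =>
    intro g z hz t
    simp at hz
    subst hz
    by_cases ht : t = 0
    · subst ht; simp [binTail, evP]
    · simp [binTail, evP, ht]
  | succ n ih =>
    intro g z hz t
    rw [evP_succ]
    simp only [maskL_cons, if_true, Bool.false_eq_true, if_false]
    rw [List.ofFn_succ, List.sublist_cons_iff] at hz
    rcases hz with hz | ⟨r, rfl, hz⟩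
    · have h0 := ih _ _ hz t
      have h1 := h0.trans (evP_mono hp0 hp1 (F := fun ω => ∃ w : List α, t ≤ w.length ∧
        w.Sublist z ∧ w.Sublist (g 0 :: maskL (fun i => g i.succ) ω))
        (fun ω ⟨w, a, b, c⟩ => ⟨w, a, b, c.cons _⟩))
      nlinarith [mul_le_mul_of_nonneg_left h1 hp0,
        mul_le_mul_of_nonneg_left h0 (sub_nonneg.2 hp1)]
    · rw [List.length_cons, binTail_succ]
      apply add_le_add
      · apply mul_le_mul_of_nonneg_left _ hp0
        refine (ih _ _ hz (t - 1)).trans (evP_mono hp0 hp1 ?_)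
        rintro ω ⟨w, a, b, c⟩
        exact ⟨g 0 :: w, by simp; omega, b.cons_cons _, c.cons_cons _⟩
      · apply mul_le_mul_of_nonneg_left _ (sub_nonneg.2 hp1)
        refine (ih _ _ hz t).trans (evP_mono hp0 hp1 ?_)
        rintro ω ⟨w, a, b, c⟩
        exact ⟨w, a, b.cons _, c⟩

/-- If `x` and `y` have a common subsequence of length `L` and `x'` is obtained from `x`
by keeping each position independently with probability `p`, then `L(x',y)`
stochastically dominates `Bin(L,p)`: for every `t`, the probability that
`L(x',y) ≥ t` is at least `P[Bin(L,p) ≥ t]`. -/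
theorem lcs_subsample_dominates_binomial {α : Type*} (n L : ℕ) (x y : List α)
    (hx : x.length = n)
    (hL : ∃ z : List α, z.length = L ∧ z.Sublist x ∧ z.Sublist y)
    (p : ℝ) (hp0 : 0 ≤ p) (hp1 : p ≤ 1) (t : ℕ) :
    ∑ j ∈ Finset.Icc t L, (L.choose j : ℝ) * p ^ j * (1 - p) ^ (L - j) ≤
      ∑ ω ∈ Finset.univ.filter (fun ω : Fin n → Bool =>
          t ≤ lcs (((List.finRange n).filter (fun i => ω i)).map
            (fun i => x.get (Fin.cast hx.symm i))) y),
        ∏ i, if ω i then p else 1 - p := by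
  subst hx
  obtain ⟨z, rfl, hzx, hzy⟩ := hL
  rw [binTail_eq]
  have h := key hp0 hp1 x.length (fun i => x.get i) z (by simpa using hzx) t
  refine (h.trans (evP_mono hp0 hp1 (F := fun ω => t ≤ lcs (maskL (fun i => x.get i) ω) y) ?_)).trans (le_of_eq ?_)
  swap
  · unfold evP maskL
    congr!
  rintro ω ⟨w, a, b, c⟩
  refine a.trans (le_csSup ⟨y.length, ?_⟩ ⟨w, rfl, c, b.trans hzy⟩)
  rintro m ⟨v, rfl, -, hv⟩
  exact hv.length_le
end
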